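/- arXiv:1502.00776 — 3 statements merged into one kernel-verified Lean document; each statement's English description precedes it below -/
import Mathlib

section
/- For every integer k ≥ 1, the following are equivalent: (i) for every non-bipartite binary Cayley graph G, every graph homomorphism from G to PC_{2k} is surjective; (ii) for every integer r ≥ k, every graph homomorphism from PC_{2r} to PC_{2k} is surjective. -/
open SimpleGraph

/-- The Cayley graph of the binary group `(ℤ/2ℤ)^n` with connection set `Ω`:
vertices are the vectors, and `u ~ v` iff `u ≠ v` and `u + v ∈ Ω`. -/
def binCayley {n : ℕ} (Ω : Set (Fin n → ZMod 2)) : SimpleGraph (Fin n → ZMod 2) :=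
  SimpleGraph.fromRel (fun u v => u + v ∈ Ω)

/-- The projective cube of dimension `d`: the Cayley graph of `(ℤ/2ℤ)^d` whose
connection set consists of the standard basis vectors together with the all-ones vector. -/
def projCube (d : ℕ) : SimpleGraph (Fin d → ZMod 2) :=
  binCayley ({x | ∃ i, x = Pi.single i 1} ∪ {x | x = fun _ => 1})

theorem add_mem_of_binCayley_adj {n : ℕ} {Ω : Set (Fin n → ZMod 2)} {u v : Fin n → ZMod 2}
    (h : (binCayley Ω).Adj u v) : u + v ∈ Ω := by
  rcases (SimpleGraph.fromRel_adj _ _ _).1 h with ⟨-, h | h⟩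
  · exact h
  · rwa [add_comm]

theorem binCayley_adj_of_add_mem {n : ℕ} {Ω : Set (Fin n → ZMod 2)} (h0 : 0 ∉ Ω)
    {u v : Fin n → ZMod 2} (h : u + v ∈ Ω) : (binCayley Ω).Adj u v := by
  refine (SimpleGraph.fromRel_adj _ _ _).2 ⟨?_, Or.inl h⟩
  rintro rfl
  rw [ZModModule.add_self] at h
  exact h0 h

/-- The steps of a walk in a binary Cayley graph sum to the difference of its endpoints. -/
theorem exists_list_of_walk {n : ℕ} {Ω : Set (Fin n → ZMod 2)} {u v : Fin n → ZMod 2}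
    (w : (binCayley Ω).Walk u v) :
    ∃ l : List (Fin n → ZMod 2), (∀ a ∈ l, a ∈ Ω) ∧ l.length = w.length ∧ l.sum = u + v := by
  induction w with
  | nil => exact ⟨[], by simp, rfl, by simp [ZModModule.add_self]⟩
  | @cons a b c h w ih =>
    obtain ⟨l, hl, hlen, hsum⟩ := ih
    refine ⟨(a + b) :: l, ?_, by simp [hlen], ?_⟩
    · simpa using ⟨add_mem_of_binCayley_adj h, hl⟩
    · rw [List.sum_cons, hsum, ZModModule.add_add_add_cancel]

theorem projCube_connection_zero_notMem {d : ℕ} (hd : 1 ≤ d) :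
    (0 : Fin d → ZMod 2) ∉
      ({x | ∃ i, x = Pi.single i 1} ∪ {x | x = fun _ => 1} : Set (Fin d → ZMod 2)) := by
  rintro (⟨i, hi⟩ | h)
  · simpa using congrFun hi i
  · exact zero_ne_one (congrFun h ⟨0, hd⟩)

/-- If `d + 1` elements `ω₀, …, ω_d` of `Ω` sum to zero, then `x ↦ ∑ xᵢ ωᵢ` is a homomorphism
from `PC_d` to the Cayley graph of `Ω`. -/
def projCubeHom {n d : ℕ} {Ω : Set (Fin n → ZMod 2)} (h0 : 0 ∉ Ω)
    (ω : Fin (d + 1) → Fin n → ZMod 2) (hω : ∀ i, ω i ∈ Ω) (hsum : ∑ i, ω i = 0) :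
    projCube d →g binCayley Ω where
  toFun x := ∑ i : Fin d, x i • ω i.castSucc
  map_rel' := by
    intro u v h
    apply binCayley_adj_of_add_mem h0
    rw [← Finset.sum_add_distrib]
    simp_rw [← add_smul, ← Pi.add_apply u v]
    rcases add_mem_of_binCayley_adj h with ⟨i, hi⟩ | hJ
    · rw [hi, Finset.sum_eq_single i]
      · simpa using hω i.castSucc
      · intro j _ hj
        simp [Pi.single_eq_of_ne hj]
      · simp
    · rw [Set.mem_ofPred_eq] at hJ
      rw [Fin.sum_univ_castSucc, add_eq_zero_iff_eq_neg,
        ZModModule.neg_eq_self] at hsum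
      rw [hJ]
      simpa [hsum] using hω (Fin.last d)

/-- The walk switching on the first `m` coordinates one after the other is a path. -/
theorem exists_isPath_projCube {d : ℕ} (hd : 1 ≤ d) {m : ℕ} (hm : m ≤ d) :
    ∃ p : (projCube d).Walk 0 (fun i => if (i : ℕ) < m then 1 else 0),
      p.IsPath ∧ p.length = m ∧ ∀ x ∈ p.support, ∀ j : Fin d, m ≤ j → x j = 0 := by
  induction m with
  | zero => exact ⟨Walk.nil' 0, by simp, by simp, by simp⟩
  | succ m ih =>
    obtain ⟨p, hp, hlen, hsupp⟩ := ih (by omega)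
    have hadj : (projCube d).Adj (fun i => if (i : ℕ) < m then 1 else 0)
        (fun i => if (i : ℕ) < m + 1 then 1 else 0) := by
      refine binCayley_adj_of_add_mem (projCube_connection_zero_notMem hd)
        (Or.inl ⟨⟨m, hm⟩, funext fun i => ?_⟩)
      rcases lt_trichotomy (i : ℕ) m with h | h | h
      · simp [Fin.ext_iff, h, h.ne, h.le, CharTwo.add_self_eq_zero]
      · simp [Pi.single_apply, Fin.ext_iff, h]
      · simp [Fin.ext_iff, h, h.ne', h.not_gt]
    refine ⟨p.concat hadj, hp.concat (fun hmem => ?_) hadj, by simp [hlen], fun x hx j hj => ?_⟩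
    · simpa using hsupp _ hmem ⟨m, hm⟩ le_rfl
    · rw [Walk.support_concat, List.mem_append, List.mem_singleton] at hx
      rcases hx with hx | rfl
      · exact hsupp x hx j (by omega)
      · simp [show ¬ (j : ℕ) < m + 1 by omega]

theorem exists_isCycle_odd_projCube {r : ℕ} (hr : 1 ≤ r) :
    ∃ (u : Fin (2 * r) → ZMod 2) (w : (projCube (2 * r)).Walk u u), w.IsCycle ∧ Odd w.length := by
  obtain ⟨p, hp, hlen, -⟩ := exists_isPath_projCube (d := 2 * r) (by omega) le_rfl
  have hadj : (projCube (2 * r)).Adj (fun i => if (i : ℕ) < 2 * r then 1 else 0) 0 :=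
    binCayley_adj_of_add_mem (projCube_connection_zero_notMem (by omega))
      (Or.inr (by funext i; simp))
  refine ⟨_, Walk.cons hadj p, (Walk.cons_isCycle_iff p hadj).2 ⟨hp, fun hmem => ?_⟩, ?_⟩
  · have := hp.length_eq_one_of_mem_edges (Sym2.eq_swap ▸ hmem)
    omega
  · exact ⟨r, by simp [hlen]⟩

/-- For every `k ≥ 1`, the statement that every homomorphism from a non-bipartite
binary Cayley graph to `PC_{2k}` is surjective is equivalent to the statement that
for every `r ≥ k`, every homomorphism from `PC_{2r}` to `PC_{2k}` is surjective. -/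
theorem binCayley_onto_iff_projCube_onto (k : ℕ) (hk : 1 ≤ k) :
    (∀ (n : ℕ) (Ω : Set (Fin n → ZMod 2)), 0 ∉ Ω →
        (∃ (u : Fin n → ZMod 2) (w : (binCayley Ω).Walk u u), w.IsCycle ∧ Odd w.length) →
        ∀ f : binCayley Ω →g projCube (2 * k), Function.Surjective f) ↔
    (∀ r : ℕ, k ≤ r →
        ∀ f : projCube (2 * r) →g projCube (2 * k), Function.Surjective f) := by
  constructor
  · intro h r hr f
    exact h (2 * r) _ (projCube_connection_zero_notMem (by omega))
      (exists_isCycle_odd_projCube (hk.trans hr)) f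
  · rintro h n Ω h0 ⟨u, w, -, t, ht⟩ f
    obtain ⟨l, hl, hlen, hsum⟩ := exists_list_of_walk w
    rw [ZModModule.add_self] at hsum
    obtain ⟨a, ha⟩ := List.exists_mem_of_length_pos (l := l) (by omega)
    have hlen' : (l ++ List.replicate (2 * k) a).length = 2 * (t + k) + 1 := by
      simp only [List.length_append, List.length_replicate]
      omega
    have hsum' : (l ++ List.replicate (2 * k) a).sum = 0 := by
      rw [List.sum_append, hsum, List.sum_replicate, mul_nsmul, two_nsmul,
        ZModModule.add_self, smul_zero, add_zero]
    have hmem : ∀ b ∈ l ++ List.replicate (2 * k) a, b ∈ Ω := by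
      intro b hb
      rcases List.mem_append.1 hb with hb | hb
      · exact hl b hb
      · exact List.eq_of_mem_replicate hb ▸ hl a ha
    generalize l ++ List.replicate (2 * k) a = L at hlen' hsum' hmem
    have hsurj := h (t + k) (by omega) (f.comp (projCubeHom h0 (fun i => L.get (i.cast hlen'.symm))
      (fun i => hmem _ (L.get_mem _)) (by
        rw [← hsum', ← Fin.sum_univ_getElem]
        exact Fintype.sum_equiv (finCongr hlen'.symm) _ _ (fun _ => rfl))))
    exact Function.Surjective.of_comp hsurj
end

section
/- Let k ≥ 1 and let f : PC_{2k+2} → PC_{2k} be a graph homomorphism. If some vertex x of PC_{2k} satisfies |f⁻¹(x)| ≥ 5, then there exists a vertex a of PC_{2k+2} such that f⁻¹(x) is contained in the neighborhood N(a) of a. -/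
open SimpleGraph

open scoped Finset

lemma zmod_two_ite_ne (a b : ZMod 2) : (if a ≠ b then (1 : ZMod 2) else 0) = a + b := by
  revert a b; decide

lemma hammingDist_eq_sum_ite {ι : Type*} [Fintype ι] (u v : ι → ZMod 2) :
    hammingDist u v = ∑ i, if u i ≠ v i then 1 else 0 := by
  simp only [hammingDist, Finset.card_filter]

lemma natCast_hammingDist {ι : Type*} [Fintype ι] (u v : ι → ZMod 2) :
    (hammingDist u v : ZMod 2) = ∑ i, (u i + v i) := by
  rw [hammingDist_eq_sum_ite]
  push_cast
  exact Finset.sum_congr rfl fun i _ => zmod_two_ite_ne _ _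

lemma hammingDist_parity {ι : Type*} [Fintype ι] (u v w : ι → ZMod 2) :
    hammingDist u w % 2 = (hammingDist u v + hammingDist v w) % 2 := by
  change hammingDist u w ≡ _ [MOD 2]
  rw [← ZMod.natCast_eq_natCast_iff]
  push_cast
  simp only [natCast_hammingDist, ← Finset.sum_add_distrib]
  refine Finset.sum_congr rfl fun i _ => ?_
  linear_combination -CharTwo.add_self_eq_zero (v i)

lemma hammingDist_add_one_add {d : ℕ} (u v : Fin d → ZMod 2) :
    hammingDist (u + 1) v + hammingDist u v = d := by
  simp only [hammingDist_eq_sum_ite, ← Finset.sum_add_distrib]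
  have h : ∀ a b : ZMod 2,
      ((if a + 1 ≠ b then 1 else 0) + (if a ≠ b then 1 else 0) : ℕ) = 1 := by decide
  simp only [Pi.add_apply, Pi.one_apply, h]
  simp

lemma hammingDist_add_single {d : ℕ} (u : Fin d → ZMod 2) (i : Fin d) :
    hammingDist (u + Pi.single i 1) u = 1 := by
  have : (Finset.univ.filter fun j => (u + Pi.single i 1 : Fin d → ZMod 2) j ≠ u j) = {i} := by
    ext j
    by_cases h : j = i <;> simp [h, Pi.single_apply]
  rw [hammingDist, this, Finset.card_singleton]

lemma zmod_two_pi_add_self {ι : Type*} (u : ι → ZMod 2) : u + u = 0 :=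
  funext fun _ => CharTwo.add_self_eq_zero _

lemma projCube_adj_add_single {d : ℕ} (u : Fin d → ZMod 2) (i : Fin d) :
    (projCube d).Adj (u + Pi.single i 1) u := by
  refine ⟨fun h => ?_, Or.inl (Or.inl ⟨i, ?_⟩)⟩
  · have := hammingDist_add_single u i
    rw [h, hammingDist_self] at this
    exact zero_ne_one this
  · rw [add_right_comm, zmod_two_pi_add_self, zero_add]

lemma projCube_adj_add_one {d : ℕ} (hd : 0 < d) (u : Fin d → ZMod 2) :
    (projCube d).Adj (u + 1) u := by
  refine ⟨fun h => ?_, Or.inl (Or.inr ?_)⟩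
  · have := congrFun h ⟨0, hd⟩
    simp at this
  · change u + 1 + u = 1
    rw [add_right_comm, zmod_two_pi_add_self, zero_add]

lemma projCube_adj_cases {d : ℕ} {u v : Fin d → ZMod 2} (h : (projCube d).Adj u v) :
    (∃ i, u = v + Pi.single i 1) ∨ u = v + 1 := by
  have key : ∀ w, u + v = w → u = v + w := by
    rintro _ rfl
    rw [add_left_comm, zmod_two_pi_add_self, add_zero]
  obtain ⟨-, h⟩ := h
  have h : u + v ∈ ({x | ∃ i, x = Pi.single i 1} ∪ {x | x = fun _ => 1} :
      Set (Fin d → ZMod 2)) := by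
    rcases h with h | h
    · exact h
    · rwa [add_comm]
  rcases h with ⟨i, h⟩ | h
  · exact Or.inl ⟨i, key _ h⟩
  · exact Or.inr (key _ h)

lemma projCube_walk_length {d : ℕ} {u v : Fin d → ZMod 2} (p : (projCube d).Walk u v) :
    (hammingDist u v ≤ p.length ∧ hammingDist u v % 2 = p.length % 2) ∨
      (d + 1 ≤ p.length + hammingDist u v ∧
        (d + 1) % 2 = (p.length + hammingDist u v) % 2) := by
  induction p with
  | nil => simp
  | @cons u v w h p ih =>
    rw [Walk.length_cons]
    rcases projCube_adj_cases h with ⟨i, rfl⟩ | rfl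
    · have h1 := hammingDist_add_single v i
      have h2 := hammingDist_parity (v + Pi.single i 1) v w
      have h3 := hammingDist_triangle (v + Pi.single i 1) v w
      have h4 := hammingDist_triangle v (v + Pi.single i 1) w
      rw [hammingDist_comm v (v + Pi.single i 1)] at h4
      omega
    · have h1 := hammingDist_add_one_add v w
      omega

lemma projCube_odd_closed_walk {k : ℕ} {u : Fin (2 * k) → ZMod 2}
    (p : (projCube (2 * k)).Walk u u) (hp : p.length % 2 = 1) : 2 * k + 1 ≤ p.length := by
  have := projCube_walk_length p
  rw [hammingDist_self] at this
  omega

lemma projCube_exists_walk {d : ℕ} (u v : Fin d → ZMod 2) :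
    ∃ p : (projCube d).Walk u v, p.length = hammingDist u v := by
  induction h : hammingDist u v generalizing u with
  | zero =>
    obtain rfl := hammingDist_eq_zero.mp h
    exact ⟨.nil, rfl⟩
  | succ n ih =>
    obtain ⟨i, hi⟩ : ∃ i, u i ≠ v i := by
      by_contra! hc
      rw [funext hc, hammingDist_self] at h
      omega
    have hs : hammingDist u v = hammingDist (u + Pi.single i 1) v + 1 := by
      have : (Finset.univ.filter fun j => u j ≠ v j) =
          insert i (Finset.univ.filter fun j => (u + Pi.single i 1 : Fin d → ZMod 2) j ≠ v j) := by
        ext j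
        by_cases hj : j = i
        · subst hj; simpa using hi
        · simp [hj, Pi.single_apply]
      rw [hammingDist, this, Finset.card_insert_of_notMem]
      · rfl
      · have : ∀ a b : ZMod 2, a ≠ b → a + 1 = b := by decide
        simp [this _ _ hi]
    obtain ⟨p, hp⟩ := ih (u + Pi.single i 1) (by omega)
    exact ⟨.cons (projCube_adj_add_single u i).symm p, by rw [Walk.length_cons, hp]⟩

lemma hammingDist_of_hom_eq {k : ℕ} (f : projCube (2 * k + 2) →g projCube (2 * k))
    {u v : Fin (2 * k + 2) → ZMod 2} (huv : u ≠ v) (hf : f u = f v) :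
    hammingDist u v = 2 ∨ hammingDist u v = 2 * k + 1 := by
  have hpos := hammingDist_pos.mpr huv
  have hle : hammingDist u v ≤ 2 * k + 2 := by
    simpa using hammingDist_le_card_fintype (x := u) (y := v)
  obtain ⟨p, hp⟩ := projCube_exists_walk u v
  obtain ⟨q, hq⟩ := projCube_exists_walk (u + 1) v
  have h1 := projCube_odd_closed_walk ((p.map f).copy rfl hf.symm)
  have h2 := projCube_odd_closed_walk
    (((q.cons (projCube_adj_add_one (by omega) u).symm).map f).copy rfl hf.symm)
  simp only [Walk.length_copy, Walk.length_map, Walk.length_cons] at h1 h2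
  have h3 := hammingDist_add_one_add u v
  omega

/-- The even-weight representative of `v` in the folded-cube presentation of the projective
cube, in which the all-ones vector is the generator indexed by `none`. -/
def evenLift {d : ℕ} (v : Fin d → ZMod 2) : Option (Fin d) → ZMod 2 :=
  fun o => o.elim 0 v + ∑ i, v i

lemma evenLift_injective {d : ℕ} : Function.Injective (evenLift (d := d)) := by
  intro u v h
  have h0 : ∑ i, u i = ∑ i, v i := by simpa [evenLift] using congrFun h none
  funext i
  simpa [evenLift, h0] using congrFun h (some i)

lemma hammingDist_evenLift {k : ℕ} {u v : Fin (2 * k + 2) → ZMod 2}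
    (h : hammingDist u v = 2 ∨ hammingDist u v = 2 * k + 1) :
    hammingDist (evenLift u) (evenLift v) = 2 := by
  have hs := natCast_hammingDist u v
  rw [Finset.sum_add_distrib] at hs
  rw [hammingDist_eq_sum_ite, Fintype.sum_option]
  have hc := hammingDist_add_one_add u v
  rcases h with h | h
  · have h0 : ∑ i, u i = ∑ i, v i := by
      rw [h] at hs
      exact CharTwo.add_eq_zero.mp (hs.symm.trans (by decide))
    simpa [evenLift, h0, hammingDist_eq_sum_ite] using h
  · have h0 : ∑ i, v i = ∑ i, u i + 1 := by
      rw [h] at hs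
      push_cast at hs
      rw [show (2 : ZMod 2) = 0 from by decide, zero_mul, zero_add] at hs
      rw [hs, ← add_assoc, CharTwo.add_self_eq_zero, zero_add]
    have h1 : hammingDist (u + 1) v = 1 := by omega
    have h2 : ∀ a b c : ZMod 2, (a + c ≠ b + (c + 1)) ↔ (a + 1 ≠ b) := by decide
    rw [hammingDist_eq_sum_ite] at h1
    simp only [evenLift, h0, Option.elim, h2]
    simp only [Pi.add_apply, Pi.one_apply] at h1
    rw [h1]
    simp

lemma exists_mem_of_pairwise_inter {α : Type*} [DecidableEq α] {F : Finset (Finset α)}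
    (hF : 4 ≤ #F) (h2 : ∀ A ∈ F, #A = 2)
    (hi : ∀ A ∈ F, ∀ B ∈ F, (A ∩ B).Nonempty) : ∃ c, ∀ A ∈ F, c ∈ A := by
  obtain ⟨A, hA, B, hB, hAB⟩ := Finset.one_lt_card.mp (show 1 < #F by omega)
  obtain ⟨p, hp⟩ := hi A hA B hB
  rw [Finset.mem_inter] at hp
  refine ⟨p, ?_⟩
  by_contra! hc
  obtain ⟨C, hC, hpC⟩ := hc
  obtain ⟨D, hD, hDn⟩ : ∃ D ∈ F, D ∉ ({A, B, C} : Finset (Finset α)) :=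
    Finset.exists_mem_notMem_of_card_lt_card (Finset.card_le_three.trans_lt hF)
  simp only [Finset.mem_insert, Finset.mem_singleton, not_or] at hDn
  have pair : ∀ X ∈ F, ∀ y ∈ X, ∃ z, z ≠ y ∧ X = {y, z} := by
    intro X hX y hy
    obtain ⟨a, b, hab, rfl⟩ := Finset.card_eq_two.mp (h2 X hX)
    rcases Finset.mem_insert.mp hy with rfl | hy
    · exact ⟨b, hab.symm, rfl⟩
    · rw [Finset.mem_singleton] at hy
      subst hy
      exact ⟨a, hab, Finset.pair_comm _ _⟩
  obtain ⟨q, hq, rfl⟩ := pair A hA p hp.1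
  obtain ⟨r, hr, rfl⟩ := pair B hB p hp.2
  have hqr : q ≠ r := by rintro rfl; exact hAB rfl
  have memC : ∀ y, {p, y} ∈ F → y ∈ C := by
    intro y hy
    obtain ⟨z, hz⟩ := hi _ hy C hC
    simp only [Finset.mem_inter, Finset.mem_insert, Finset.mem_singleton] at hz
    rcases hz with ⟨rfl | rfl, hz⟩
    · exact absurd hz hpC
    · exact hz
  have eqC : ∀ X ∈ F, q ∈ X → r ∈ X → X = {q, r} := by
    intro X hX h1 h2'
    refine (Finset.eq_of_subset_of_card_le ?_ ?_).symm
    · simp [Finset.insert_subset_iff, h1, h2']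
    · rw [h2 X hX, Finset.card_pair hqr]
  obtain rfl := eqC C hC (memC q hA) (memC r hB)
  by_cases hpD : p ∈ D
  · obtain ⟨z, -, rfl⟩ := pair D hD p hpD
    have := memC z hD
    simp only [Finset.mem_insert, Finset.mem_singleton] at this
    rcases this with rfl | rfl
    · exact hDn.1 rfl
    · exact hDn.2.1 rfl
  · have mem : ∀ y, {p, y} ∈ F → y ∈ D := by
      intro y hy
      obtain ⟨z, hz⟩ := hi _ hy D hD
      simp only [Finset.mem_inter, Finset.mem_insert, Finset.mem_singleton] at hz
      rcases hz with ⟨rfl | rfl, hz⟩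
      · exact absurd hz hpD
      · exact hz
    exact hDn.2.2 (eqC D hD (mem q hA) (mem r hB))

lemma exists_add_single_of_equidistant_two {ι : Type*} [Fintype ι] [DecidableEq ι]
    {S : Finset (ι → ZMod 2)} (hS : 5 ≤ #S)
    (hd : ∀ s ∈ S, ∀ t ∈ S, s ≠ t → hammingDist s t = 2) :
    ∃ c : ι → ZMod 2, ∀ s ∈ S, ∃ j, c = s + Pi.single j 1 := by
  obtain ⟨u, hu⟩ : S.Nonempty := Finset.card_pos.mp (by omega)
  let D : (ι → ZMod 2) → Finset ι := fun s => Finset.univ.filter fun i => u i ≠ s i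
  have two : ∀ a b c : ZMod 2, a ≠ b → a ≠ c → b = c := by decide
  have D_inj : Function.Injective D := by
    intro s t h
    funext i
    have hi := Finset.ext_iff.mp h i
    simp only [D, Finset.mem_filter, Finset.mem_univ, true_and] at hi
    by_cases h1 : u i = s i
    · by_contra hne
      exact hi.mpr (fun h => hne (h1.symm.trans h)) h1
    · exact two _ _ _ h1 (hi.mp h1)
  have D_card : ∀ s ∈ S.erase u, #(D s) = 2 := fun s hs =>
    hd u hu s (Finset.mem_of_mem_erase hs) (Finset.ne_of_mem_erase hs).symm
  have D_inter : ∀ s ∈ S.erase u, ∀ t ∈ S.erase u, (D s ∩ D t).Nonempty := by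
    intro s hs t ht
    by_contra hne
    rw [Finset.not_nonempty_iff_eq_empty, ← Finset.disjoint_iff_inter_eq_empty] at hne
    have h4 : #(D s ∪ D t) = 4 := by
      rw [Finset.card_union_of_disjoint hne, D_card s hs, D_card t ht]
    have hle : #(D s ∪ D t) ≤ hammingDist s t := by
      refine Finset.card_le_card fun i hi => ?_
      have hdis : i ∈ D s → i ∉ D t := fun h => Finset.disjoint_left.mp hne h
      simp only [D, Finset.mem_union, Finset.mem_filter, Finset.mem_univ, true_and] at hi hdis ⊢
      grind
    by_cases hst : s = t
    · subst hst
      rw [hammingDist_self] at hle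
      omega
    · rw [hd s (Finset.mem_of_mem_erase hs) t (Finset.mem_of_mem_erase ht) hst] at hle
      omega
  obtain ⟨c, hc⟩ := exists_mem_of_pairwise_inter (F := (S.erase u).image D)
    (by rw [Finset.card_image_of_injective _ D_inj, Finset.card_erase_of_mem hu]; omega)
    (by simpa only [Finset.forall_mem_image] using D_card)
    (by simpa only [Finset.forall_mem_image] using D_inter)
  rw [Finset.forall_mem_image] at hc
  refine ⟨u + Pi.single c 1, fun s hs => ?_⟩
  by_cases hsu : s = u
  · exact ⟨c, by rw [hsu]⟩
  have hs' := Finset.mem_erase.mpr ⟨hsu, hs⟩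
  obtain ⟨j, hj⟩ : ∃ j, (D s).erase c = {j} := by
    rw [← Finset.card_eq_one, Finset.card_erase_of_mem (hc hs'), D_card s hs']
  refine ⟨j, funext fun i => ?_⟩
  have hci := hc hs'
  have hij := Finset.ext_iff.mp hj i
  have hjj := Finset.ext_iff.mp hj j
  have add_one : ∀ a b : ZMod 2, a ≠ b → a + 1 = b := by decide
  simp only [D, Finset.mem_erase, Finset.mem_filter, Finset.mem_univ, true_and,
    Finset.mem_singleton] at hci hij hjj
  have hjc : j ≠ c := (hjj.mpr trivial).1
  simp only [Pi.add_apply, Pi.single_apply]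
  by_cases h1 : i = c
  · subst h1
    simp [hjc.symm, add_one _ _ hci]
  · by_cases h2 : i = j
    · subst h2
      simp [h1, add_one _ _ (hij.mpr rfl).2.symm]
    · simp only [h1, h2, if_false, add_zero]
      by_contra h3
      exact h2 (hij.mp ⟨h1, h3⟩)

lemma projCube_adj_of_evenLift {d : ℕ} (hd : 0 < d) {s : Fin d → ZMod 2}
    {c : Option (Fin d) → ZMod 2} {j : Option (Fin d)} (h : c = evenLift s + Pi.single j 1) :
    (projCube d).Adj (fun i => c (some i) + c none) s := by
  have two (a b : ZMod 2) : a + b + b = a := by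
    rw [add_assoc, CharTwo.add_self_eq_zero, add_zero]
  subst h
  cases j with
  | none =>
    convert projCube_adj_add_one hd s using 1
    funext i
    simp [evenLift, ← add_assoc, two]
  | some j =>
    convert projCube_adj_add_single s j using 1
    funext i
    simp only [evenLift, Pi.add_apply, Pi.single_apply, Option.elim, Option.some.injEq,
      reduceCtorEq, if_false, add_zero, zero_add]
    rw [add_right_comm, two]

/-- If `f : PC_{2k+2} → PC_{2k}` is a homomorphism and some vertex `x` of `PC_{2k}`
has at least `5` pre-images, then the pre-image of `x` is contained in the
neighborhood of some vertex `a` of `PC_{2k+2}`. -/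
theorem projCube_hom_large_fiber_in_neighborhood (k : ℕ) (hk : 1 ≤ k)
    (f : projCube (2 * k + 2) →g projCube (2 * k))
    (x : Fin (2 * k) → ZMod 2) (hx : 5 ≤ (⇑f ⁻¹' {x}).ncard) :
    ∃ a, ⇑f ⁻¹' {x} ⊆ (projCube (2 * k + 2)).neighborSet a := by
  classical
  have hpos : 0 < 2 * k + 2 := by omega
  let S := (Set.toFinite (⇑f ⁻¹' {x})).toFinset
  have mem_S : ∀ s, s ∈ S ↔ f s = x := fun s => by simp [S]
  have hS : 5 ≤ #(S.image evenLift) := by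
    rwa [Finset.card_image_of_injective _ evenLift_injective, ← Set.ncard_eq_toFinset_card]
  obtain ⟨c, hc⟩ := exists_add_single_of_equidistant_two hS <| by
    simp only [Finset.forall_mem_image]
    intro s hs t ht hst
    refine hammingDist_evenLift (hammingDist_of_hom_eq f (fun h => hst (by rw [h])) ?_)
    rw [(mem_S s).mp hs, (mem_S t).mp ht]
  refine ⟨fun i => c (some i) + c none, fun s hs => ?_⟩
  obtain ⟨j, hj⟩ := hc _ (Finset.mem_image_of_mem evenLift ((mem_S s).mpr hs))
  exact projCube_adj_of_evenLift hpos hj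
end

section
/- For every integer k ≥ 1, the (2k−1)-th walk power of the projective cube PC_{2k} is isomorphic to the complete graph K_{2^{2k}} on 2^{2k} vertices; that is, any two distinct vertices of PC_{2k} are joined by a walk of length 2k−1, and no vertex has a closed walk of length 2k−1 to itself. -/
open SimpleGraph

/-- The `l`-th walk power of `G`: distinct vertices `x` and `y` are adjacent iff
there is a walk of length `l` from `x` to `y` in `G`. -/
def walkPower {V : Type*} (G : SimpleGraph V) (l : ℕ) : SimpleGraph V :=
  SimpleGraph.fromRel (fun x y => ∃ w : G.Walk x y, w.length = l)

lemma binCayley_adj {n : ℕ} {Ω : Set (Fin n → ZMod 2)} {u v : Fin n → ZMod 2} :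
    (binCayley Ω).Adj u v ↔ u ≠ v ∧ u + v ∈ Ω := by
  simp [binCayley, SimpleGraph.fromRel_adj, add_comm v u]

lemma binCayley_adj_add {n : ℕ} {Ω : Set (Fin n → ZMod 2)} {g : Fin n → ZMod 2}
    (hg : g ∈ Ω) (h0 : g ≠ 0) (u : Fin n → ZMod 2) : (binCayley Ω).Adj u (u + g) := by
  refine binCayley_adj.2 ⟨by simpa using h0, ?_⟩
  have huu : u + u = 0 := funext fun i => CharTwo.add_self_eq_zero (u i)
  rwa [← add_assoc, huu, zero_add]

/-- A walk in the projective cube determines how often each generator is used. -/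
lemma projCube_walk_counts {d : ℕ} {x y : Fin d → ZMod 2} (w : (projCube d).Walk x y) :
    ∃ (c : Fin d → ℕ) (j : ℕ), ∑ i, c i + j = w.length ∧
      ∀ i, (c i : ZMod 2) + j = x i + y i := by
  induction w with
  | nil => exact ⟨0, 0, by simp, fun i => by simp [CharTwo.add_self_eq_zero]⟩
  | @cons u v y h p ih =>
    obtain ⟨c, j, hl, hc⟩ := ih
    have two (a : ZMod 2) : a + a = 0 := CharTwo.add_self_eq_zero a
    rcases (binCayley_adj.1 h).2 with ⟨i₀, h₀⟩ | h₀
    · refine ⟨c + Pi.single i₀ 1, j, ?_, fun i => ?_⟩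
      · simp [Finset.sum_add_distrib, ← hl]
        ring
      · have hi : u i + v i = Pi.single (M := fun _ => ZMod 2) i₀ 1 i := congrFun h₀ i
        have hs : ((Pi.single (M := fun _ => ℕ) i₀ 1 i : ℕ) : ZMod 2) =
            Pi.single (M := fun _ => ZMod 2) i₀ 1 i := by
          simp only [Pi.single_apply]
          split_ifs <;> simp
        rw [Pi.add_apply, Nat.cast_add, hs, ← hi]
        linear_combination hc i + two (v i)
    · refine ⟨c, j + 1, by simp [← hl, add_assoc], fun i => ?_⟩
      have hi : u i + v i = 1 := congrFun h₀ i
      push_cast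
      rw [← hi]
      linear_combination hc i + two (v i)

/-- Any prescribed usage of the generators is realised by a walk in the projective cube. -/
lemma projCube_exists_walk_s19 {d : ℕ} [NeZero d] (l : ℕ) (c : Fin d → ℕ) (j : ℕ)
    (x y : Fin d → ZMod 2) (hl : ∑ i, c i + j = l)
    (hc : ∀ i, (c i : ZMod 2) + j = x i + y i) :
    ∃ w : (projCube d).Walk x y, w.length = l := by
  have two (a : ZMod 2) : a + a = 0 := CharTwo.add_self_eq_zero a
  induction l generalizing c j x with
  | zero =>
    obtain ⟨h₁, rfl⟩ := Nat.add_eq_zero_iff.1 hl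
    have h₁ : ∀ i, c i = 0 := by simpa using h₁
    obtain rfl : x = y := funext fun i => by
      have := hc i
      simp only [h₁, Nat.cast_zero, add_zero] at this
      exact CharTwo.add_eq_zero.1 this.symm
    exact ⟨.nil, rfl⟩
  | succ l ih =>
    rcases j with _ | j
    · obtain ⟨i₀, h₀⟩ : ∃ i, c i ≠ 0 := by
        by_contra! h
        simp [h] at hl
      have hle : ∀ i, Pi.single (M := fun _ => ℕ) i₀ 1 i ≤ c i := fun i => by
        rcases eq_or_ne i i₀ with rfl | h
        · simpa using Nat.one_le_iff_ne_zero.2 h₀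
        · simp [h]
      obtain ⟨c', rfl⟩ : ∃ c', c = c' + Pi.single i₀ 1 :=
        ⟨c - Pi.single i₀ 1, funext fun i => (Nat.sub_add_cancel (hle i)).symm⟩
      have hadj : (projCube d).Adj x (x + Pi.single i₀ 1) :=
        binCayley_adj_add (Or.inl ⟨i₀, rfl⟩) (by simp) x
      obtain ⟨w, hw⟩ := ih c' 0 (x + Pi.single i₀ 1)
        (by simp [Finset.sum_add_distrib] at hl; simpa using hl) (fun i => by
          have hs : ((Pi.single (M := fun _ => ℕ) i₀ 1 i : ℕ) : ZMod 2) =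
              Pi.single (M := fun _ => ZMod 2) i₀ 1 i := by
            simp only [Pi.single_apply]
            split_ifs <;> simp
          have := hc i
          rw [Pi.add_apply, Nat.cast_add, hs] at this
          rw [Pi.add_apply]
          linear_combination this - two (Pi.single (M := fun _ => ZMod 2) i₀ 1 i))
      exact ⟨.cons hadj w, by simp [hw]⟩
    · have hadj : (projCube d).Adj x (x + fun _ => 1) :=
        binCayley_adj_add (Or.inr rfl) (fun h => one_ne_zero (congrFun h 0)) x
      obtain ⟨w, hw⟩ := ih c j (x + fun _ => 1) (by omega) (fun i => by
        have := hc i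
        push_cast at this
        rw [Pi.add_apply]
        linear_combination this - two 1)
      exact ⟨.cons hadj w, by simp [hw]⟩

lemma projCube_exists_walk_of_ne {k : ℕ} (hk : 1 ≤ k) {x y : Fin (2 * k) → ZMod 2}
    (hxy : x ≠ y) : ∃ w : (projCube (2 * k)).Walk x y, w.length = 2 * k - 1 := by
  have : NeZero (2 * k) := ⟨by omega⟩
  have hval : ∀ i, (x i + y i).val ≤ 1 := fun i => Nat.le_of_lt_succ (ZMod.val_lt _)
  have hsum : ∑ i, (1 - (x i + y i).val) + ∑ i, (x i + y i).val = 2 * k := by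
    rw [← Finset.sum_add_distrib]
    simp [Nat.sub_add_cancel (hval _)]
  have hpos : ∑ i, (x i + y i).val ≠ 0 := fun h => hxy <| funext fun i => by
    simp only [Finset.sum_eq_zero_iff, Finset.mem_univ, true_imp_iff, ZMod.val_eq_zero] at h
    exact CharTwo.add_eq_zero.1 (h i)
  set s := ∑ i, (x i + y i).val with hs
  rcases Nat.even_or_odd s with he | ho
  · refine projCube_exists_walk_s19 _ (fun i => 1 - (x i + y i).val) (s - 1) x y (by omega)
      fun i => ?_
    have hodd : ((s - 1 : ℕ) : ZMod 2) = 1 :=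
      ZMod.natCast_eq_one_iff_odd.2 (by grind)
    rw [hodd, Nat.cast_sub (hval i), ZMod.natCast_zmod_val]
    generalize x i + y i = a
    revert a
    decide
  · refine projCube_exists_walk_s19 _ (fun i => (x i + y i).val) (2 * k - 1 - s) x y (by grind)
      fun i => ?_
    have heven : ((2 * k - 1 - s : ℕ) : ZMod 2) = 0 :=
      ZMod.natCast_eq_zero_iff_even.2 (by grind)
    rw [heven, ZMod.natCast_zmod_val, add_zero]

lemma projCube_closed_walk_length_ne {k : ℕ} (hk : 1 ≤ k) {x : Fin (2 * k) → ZMod 2}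
    (w : (projCube (2 * k)).Walk x x) : w.length ≠ 2 * k - 1 := by
  intro hw
  obtain ⟨c, j, hl, hc⟩ := projCube_walk_counts w
  have hcj : ∀ i, (c i : ZMod 2) = j := fun i =>
    CharTwo.add_eq_zero.1 ((hc i).trans (CharTwo.add_self_eq_zero _))
  rcases Nat.even_or_odd j with he | ho
  · have : Even (∑ i, c i) := Finset.even_sum _ fun i _ =>
      ZMod.natCast_eq_zero_iff_even.1 ((hcj i).trans (ZMod.natCast_eq_zero_iff_even.2 he))
    grind
  · have hodd : ∀ i, 1 ≤ c i := fun i => Odd.pos <|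
      ZMod.natCast_eq_one_iff_odd.1 ((hcj i).trans (ZMod.natCast_eq_one_iff_odd.2 ho))
    have : ∑ _i : Fin (2 * k), 1 ≤ ∑ i, c i := Finset.sum_le_sum fun i _ => hodd i
    simp at this
    omega

/-- For every `k ≥ 1`, the `(2k-1)`-th walk power of `PC_{2k}` is the complete
graph on `2^{2k}` vertices: any two distinct vertices of `PC_{2k}` are joined by a
walk of length `2k-1`, and no vertex has a closed walk of length `2k-1` to itself. -/
theorem projCube_walkPower_complete (k : ℕ) (hk : 1 ≤ k) :
    Nonempty (walkPower (projCube (2 * k)) (2 * k - 1) ≃g completeGraph (Fin (2 ^ (2 * k)))) ∧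
    (∀ x y : Fin (2 * k) → ZMod 2, x ≠ y →
      ∃ w : (projCube (2 * k)).Walk x y, w.length = 2 * k - 1) ∧
    (∀ (x : Fin (2 * k) → ZMod 2) (w : (projCube (2 * k)).Walk x x),
      w.length ≠ 2 * k - 1) := by
  refine ⟨?_, fun x y => projCube_exists_walk_of_ne hk,
    fun x => projCube_closed_walk_length_ne hk⟩
  have htop : walkPower (projCube (2 * k)) (2 * k - 1) = completeGraph _ := by
    ext x y
    simp only [walkPower, SimpleGraph.fromRel_adj, completeGraph, SimpleGraph.top_adj]
    exact ⟨And.left, fun h => ⟨h, Or.inl (projCube_exists_walk_of_ne hk h)⟩⟩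
  rw [htop]
  exact ⟨SimpleGraph.Iso.completeGraph (Fintype.equivOfCardEq (by simp [ZMod.card]))⟩
end
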